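/- Let C142, C143, C234 be arbitrary real numbers. On the 4-dimensional real vector space with basis y1, y2, y3, y4, the skew-symmetric bilinear bracket determined by [y1,y2]=y3, [y1,y3]=y4, [y1,y4]=−C142·C234·y1 + C142·y2 + C143·y3, [y2,y3]=C234·y4, [y2,y4]=−C142·C234²·y1 + C142·C234·y2 + C143·C234·y3, [y3,y4]=0 satisfies the Jacobi identity (so it defines a Lie algebra, called ourSolDep[5]), and the 2-dimensional subspace D = span{y1,y2} is an Engel-like structure on it. -/

import Mathlib

/-- Bilinear extension of structure constants `c` to a bracket on `Fin 4 → ℝ`. -/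
noncomputable def bk (c : Fin 4 → Fin 4 → Fin 4 → ℝ) (x y : Fin 4 → ℝ) : Fin 4 → ℝ :=
  ∑ i : Fin 4, ∑ j : Fin 4, (x i * y j) • c i j

/-- Structure constants of the Engel-normalized bracket:
`[y1,y2] = y3`, `[y1,y3] = y4`, `[y1,y4] = C14`, `[y2,y3] = C23`,
`[y2,y4] = C24`, `[y3,y4] = C34`, extended skew-symmetrically. -/
noncomputable def sc (C14 C23 C24 C34 : Fin 4 → ℝ) : Fin 4 → Fin 4 → Fin 4 → ℝ :=
  ![![0, ![0, 0, 1, 0], ![0, 0, 0, 1], C14],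
    ![-![0, 0, 1, 0], 0, C23, C24],
    ![-![0, 0, 0, 1], -C23, 0, C34],
    ![-C14, -C24, -C34, 0]]

/-- The subspace spanned by all brackets `B u v` with `u ∈ S`, `v ∈ T`. -/
noncomputable def brS (B : (Fin 4 → ℝ) → (Fin 4 → ℝ) → (Fin 4 → ℝ))
    (S T : Submodule ℝ (Fin 4 → ℝ)) : Submodule ℝ (Fin 4 → ℝ) :=
  Submodule.span ℝ {z | ∃ u ∈ S, ∃ v ∈ T, z = B u v}

/-- `D` is an Engel-like structure for the bracket `B`: `D` is 2-dimensional,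
`D[2] = D + [D,D]` is 3-dimensional and `D[3] = D[2] + [D[2],D[2]]` is 4-dimensional. -/
noncomputable def IsEngelLike (B : (Fin 4 → ℝ) → (Fin 4 → ℝ) → (Fin 4 → ℝ))
    (D : Submodule ℝ (Fin 4 → ℝ)) : Prop :=
  Module.finrank ℝ D = 2 ∧
  Module.finrank ℝ ↥(D ⊔ brS B D D) = 3 ∧
  Module.finrank ℝ ↥((D ⊔ brS B D D) ⊔ brS B (D ⊔ brS B D D) (D ⊔ brS B D D)) = 4

theorem bk_formula (a b d : ℝ) (x y : Fin 4 → ℝ) :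
    bk (sc ![-a * d, a, b, 0] ![0, 0, 0, d] ![-a * d ^ 2, a * d, b * d, 0] ![0, 0, 0, 0]) x y =
    ![-a * d * ((x 0 * y 3 - x 3 * y 0) + d * (x 1 * y 3 - x 3 * y 1)),
      a * ((x 0 * y 3 - x 3 * y 0) + d * (x 1 * y 3 - x 3 * y 1)),
      (x 0 * y 1 - x 1 * y 0) + b * ((x 0 * y 3 - x 3 * y 0) + d * (x 1 * y 3 - x 3 * y 1)),
      (x 0 * y 2 - x 2 * y 0) + d * (x 1 * y 2 - x 2 * y 1)] := by
  ext k
  fin_cases k <;> simp [bk, sc, Fin.sum_univ_four] <;> ring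

theorem mem_D1 (u : Fin 4 → ℝ) :
    u ∈ Submodule.span ℝ {(![1, 0, 0, 0] : Fin 4 → ℝ), ![0, 1, 0, 0]} ↔ u 2 = 0 ∧ u 3 = 0 := by
  rw [Submodule.mem_span_pair]
  constructor
  · rintro ⟨a, b, rfl⟩
    simp
  · rintro ⟨h2, h3⟩
    refine ⟨u 0, u 1, ?_⟩
    ext k
    fin_cases k <;> simp [h2, h3]

theorem mem_D2 (u : Fin 4 → ℝ) :
    u ∈ Submodule.span ℝ {(![1, 0, 0, 0] : Fin 4 → ℝ), ![0, 1, 0, 0], ![0, 0, 1, 0]} ↔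
      u 3 = 0 := by
  rw [Submodule.mem_span_triple]
  constructor
  · rintro ⟨a, b, c, rfl⟩
    simp
  · intro h3
    refine ⟨u 0, u 1, u 2, ?_⟩
    ext k
    fin_cases k <;> simp [h3]

theorem finrank_D1 :
    Module.finrank ℝ (Submodule.span ℝ {(![1, 0, 0, 0] : Fin 4 → ℝ), ![0, 1, 0, 0]}) = 2 := by
  have h : LinearIndependent ℝ ![(![1, 0, 0, 0] : Fin 4 → ℝ), ![0, 1, 0, 0]] := by
    rw [Fintype.linearIndependent_iff]
    intro g hg i
    have h0 := congrFun hg 0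
    have h1 := congrFun hg 1
    simp [Fin.sum_univ_two] at h0 h1
    fin_cases i <;> simp [h0, h1]
  have := finrank_span_eq_card h
  have e : Set.range ![(![1, 0, 0, 0] : Fin 4 → ℝ), ![0, 1, 0, 0]] =
      {(![1, 0, 0, 0] : Fin 4 → ℝ), ![0, 1, 0, 0]} := by
    rw [Matrix.range_cons, Matrix.range_cons, Matrix.range_empty, Set.union_empty]
    rfl
  rw [e] at this
  simpa using this

theorem finrank_D2 :
    Module.finrank ℝ (Submodule.span ℝ
      {(![1, 0, 0, 0] : Fin 4 → ℝ), ![0, 1, 0, 0], ![0, 0, 1, 0]}) = 3 := by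
  have h : LinearIndependent ℝ ![(![1, 0, 0, 0] : Fin 4 → ℝ), ![0, 1, 0, 0], ![0, 0, 1, 0]] := by
    rw [Fintype.linearIndependent_iff]
    intro g hg i
    have h0 := congrFun hg 0
    have h1 := congrFun hg 1
    have h2 := congrFun hg 2
    simp [Fin.sum_univ_three] at h0 h1 h2
    fin_cases i <;> simp [h0, h1, h2]
  have := finrank_span_eq_card h
  have e : Set.range ![(![1, 0, 0, 0] : Fin 4 → ℝ), ![0, 1, 0, 0], ![0, 0, 1, 0]] =
      {(![1, 0, 0, 0] : Fin 4 → ℝ), ![0, 1, 0, 0], ![0, 0, 1, 0]} := by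
    rw [Matrix.range_cons, Matrix.range_cons, Matrix.range_cons, Matrix.range_empty,
      Set.union_empty]
    rfl
  rw [e] at this
  simpa using this

theorem ourSolDep5_lie_and_engel (C142 C143 C234 : ℝ) :
    let c := sc ![-C142 * C234, C142, C143, 0]
      ![0, 0, 0, C234]
      ![-C142 * C234 ^ 2, C142 * C234, C143 * C234, 0]
      ![0, 0, 0, 0]
    (∀ x y : Fin 4 → ℝ, bk c x y = -bk c y x) ∧
    (∀ x y z : Fin 4 → ℝ,
      bk c x (bk c y z) + bk c y (bk c z x) + bk c z (bk c x y) = 0) ∧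
    IsEngelLike (bk c)
      (Submodule.span ℝ {(![1, 0, 0, 0] : Fin 4 → ℝ), ![0, 1, 0, 0]}) := by
  intro c
  have hB : ∀ x y, bk c x y = _ := bk_formula C142 C143 C234
  refine ⟨?_, ?_, ?_⟩
  · intro x y
    rw [hB, hB]
    ext k
    fin_cases k <;> simp <;> ring
  · intro x y z
    simp only [hB]
    ext k
    fin_cases k <;> simp <;> ring
  · have h2 : Submodule.span ℝ {(![1, 0, 0, 0] : Fin 4 → ℝ), ![0, 1, 0, 0]} ⊔
        brS (bk c) (Submodule.span ℝ {(![1, 0, 0, 0] : Fin 4 → ℝ), ![0, 1, 0, 0]})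
          (Submodule.span ℝ {(![1, 0, 0, 0] : Fin 4 → ℝ), ![0, 1, 0, 0]}) =
        Submodule.span ℝ {(![1, 0, 0, 0] : Fin 4 → ℝ), ![0, 1, 0, 0], ![0, 0, 1, 0]} := by
      apply le_antisymm
      · apply sup_le
        · intro u hu
          rw [mem_D1] at hu
          rw [mem_D2]
          exact hu.2
        · refine Submodule.span_le.2 ?_
          rintro z ⟨u, hu, v, hv, rfl⟩
          rw [mem_D1] at hu hv
          rw [SetLike.mem_coe, mem_D2, hB]
          simp [hu.1, hv.1]
      · refine Submodule.span_le.2 ?_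
        rintro z (rfl | rfl | rfl)
        · exact Submodule.mem_sup_left ((mem_D1 _).2 (by simp))
        · exact Submodule.mem_sup_left ((mem_D1 _).2 (by simp))
        · refine Submodule.mem_sup_right (Submodule.subset_span
            ⟨![1, 0, 0, 0], (mem_D1 _).2 (by simp), ![0, 1, 0, 0], (mem_D1 _).2 (by simp), ?_⟩)
          rw [hB]
          simp
    refine ⟨finrank_D1, ?_, ?_⟩
    · rw [h2]
      exact finrank_D2
    · rw [h2]
      have h3 : Submodule.span ℝ {(![1, 0, 0, 0] : Fin 4 → ℝ), ![0, 1, 0, 0], ![0, 0, 1, 0]} ⊔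
        brS (bk c) (Submodule.span ℝ {(![1, 0, 0, 0] : Fin 4 → ℝ), ![0, 1, 0, 0], ![0, 0, 1, 0]})
          (Submodule.span ℝ {(![1, 0, 0, 0] : Fin 4 → ℝ), ![0, 1, 0, 0], ![0, 0, 1, 0]}) = ⊤ := by
        rw [eq_top_iff]
        intro u _
        have e : u = ![u 0, u 1, u 2, 0] + u 3 • ![0, 0, 0, 1] := by
          ext k
          fin_cases k <;> simp
        rw [e]
        refine Submodule.add_mem_sup ((mem_D2 _).2 (by simp))
          (Submodule.smul_mem _ _ (Submodule.subset_span
            ⟨![1, 0, 0, 0], (mem_D2 _).2 (by simp), ![0, 0, 1, 0], (mem_D2 _).2 (by simp), ?_⟩))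
        rw [hB]
        simp
      rw [h3, finrank_top]
      simp
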